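/- arXiv:2403.02485 — 5 statements merged into one kernel-verified Lean document; each statement's English description precedes it below -/
import Mathlib

section
/- Let d ≥ 1 and suppose K is a finite subgroup of GL_d(ℤ) of maximum order, i.e. every finite subgroup K' of GL_d(ℤ) satisfies |K'| ≤ |K|. Then the action of K on ℤ^d has no non-zero fixed points: if z ∈ ℤ^d satisfies g·z = z for every g ∈ K, then z = 0. -/
open Module in
/-- The kernel of a non-zero integral functional has corank one. -/
theorem LinearMap.nonempty_ker_prod_int_equiv {V : Type*} [AddCommGroup V] [Module.Free ℤ V]
    [Module.Finite ℤ V] {φ : V →ₗ[ℤ] ℤ} (hφ : φ ≠ 0) : Nonempty ((ker φ × ℤ) ≃ₗ[ℤ] V) := by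
  refine FiniteDimensional.nonempty_linearEquiv_of_finrank_eq ?_
  have h_range : finrank ℤ (range φ) = 1 := by
    have h_le := Submodule.finrank_le (range φ)
    have h_ne : finrank ℤ (range φ) ≠ 0 := by
      rwa [Ne, Submodule.finrank_eq_zero, LinearMap.range_eq_bot]
    rw [finrank_self] at h_le
    omega
  have h_quot := Submodule.finrank_quotient_add_finrank (ker φ)
  rw [φ.quotKerEquivRange.finrank_eq, h_range] at h_quot
  rw [finrank_prod, finrank_self, ← h_quot, add_comm]

namespace Representation

variable {G V : Type*} [Group G] [AddCommGroup V]

/-- The restriction of a representation to the kernel of an invariant functional. -/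
def restrictKer (ρ : Representation ℤ G V) (φ : V →ₗ[ℤ] ℤ) (hφ : ∀ g x, φ (ρ g x) = φ x) :
    Representation ℤ G (LinearMap.ker φ) where
  toFun g := (ρ g).restrict fun x hx => by
    rw [LinearMap.mem_ker] at hx ⊢
    rw [hφ, hx]
  map_one' := by ext; simp
  map_mul' g h := by ext; simp

/-- A faithful representation stays faithful on the kernel of an invariant functional
that does not vanish at some fixed vector. -/
theorem restrictKer_injective [Module.IsTorsionFree ℤ V] {ρ : Representation ℤ G V}
    (hρ : Function.Injective ρ) {φ : V →ₗ[ℤ] ℤ} (hφ : ∀ g x, φ (ρ g x) = φ x)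
    {v : V} (hv : ∀ g, ρ g v = v) (hφv : φ v ≠ 0) :
    Function.Injective (ρ.restrictKer φ hφ) := by
  intro g h hgh
  refine hρ (LinearMap.ext fun x => ?_)
  have h_mem : φ v • x - φ x • v ∈ LinearMap.ker φ := by
    simp [mul_comm]
  have h_eq : ρ g (φ v • x - φ x • v) = ρ h (φ v • x - φ x • v) :=
    congrArg Subtype.val (LinearMap.congr_fun hgh ⟨_, h_mem⟩)
  simp only [map_sub, map_smul, hv, sub_left_inj] at h_eq
  exact smul_right_injective V hφv h_eq

/-- The action of `G × ℤˣ` on `V × ℤ`, with `ℤˣ` acting on the second factor by scaling. -/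
def prodUnits (ρ : Representation ℤ G V) : Representation ℤ (G × ℤˣ) (V × ℤ) where
  toFun p := (ρ p.1).prodMap (LinearMap.mulLeft ℤ (p.2 : ℤ))
  map_one' := by ext <;> simp
  map_mul' p q := by ext <;> simp

theorem prodUnits_injective {ρ : Representation ℤ G V} (hρ : Function.Injective ρ) :
    Function.Injective ρ.prodUnits := by
  intro p q hpq
  refine Prod.ext (hρ (LinearMap.ext fun x => ?_)) (Units.ext ?_)
  · simpa [prodUnits] using congrArg Prod.fst (LinearMap.congr_fun hpq (x, 0))
  · simpa [prodUnits] using congrArg Prod.snd (LinearMap.congr_fun hpq (0, 1))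

/-- A faithful representation with an invariant functional not vanishing at some fixed vector
gives rise to a faithful representation of `G × ℤˣ` on the same module. -/
theorem exists_injective_prod_units [Module.Free ℤ V] [Module.Finite ℤ V]
    {ρ : Representation ℤ G V} (hρ : Function.Injective ρ) {φ : V →ₗ[ℤ] ℤ}
    (hφ : ∀ g x, φ (ρ g x) = φ x) {v : V} (hv : ∀ g, ρ g v = v) (hφv : φ v ≠ 0) :
    ∃ σ : Representation ℤ (G × ℤˣ) V, Function.Injective σ := by
  obtain ⟨e⟩ := LinearMap.nonempty_ker_prod_int_equiv (φ := φ) (by rintro rfl; simp at hφv)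
  exact ⟨e.conjRingEquiv.toMonoidHom.comp (ρ.restrictKer φ hφ).prodUnits,
    e.conjRingEquiv.injective.comp
      (prodUnits_injective (restrictKer_injective hρ hφ hv hφv))⟩

end Representation

open Matrix in
/-- A finite group of integer matrices fixing a vector `z` has an invariant functional which
does not vanish at `z` unless `z = 0`. -/
theorem Matrix.GeneralLinearGroup.exists_invariant_functional {n : Type*} [Fintype n]
    [DecidableEq n] (K : Subgroup (GL n ℤ)) [Finite K] {z : n → ℤ} (hz0 : z ≠ 0)
    (hz : ∀ g ∈ K, (g : Matrix n n ℤ) *ᵥ z = z) :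
    ∃ φ : (n → ℤ) →ₗ[ℤ] ℤ, (∀ g ∈ K, ∀ x, φ ((g : Matrix n n ℤ) *ᵥ x) = φ x) ∧ φ z ≠ 0 := by
  have := Fintype.ofFinite K
  let φ : (n → ℤ) →ₗ[ℤ] ℤ :=
    ∑ k : K, (dotProductBilin ℤ ℤ z).comp (mulVecLin ((k : GL n ℤ) : Matrix n n ℤ))
  have h_apply (x) : φ x = ∑ k : K, z ⬝ᵥ (((k : GL n ℤ) : Matrix n n ℤ) *ᵥ x) := by
    simp [φ]
  refine ⟨φ, fun g hg x => ?_, ?_⟩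
  · rw [h_apply, h_apply]
    refine Fintype.sum_equiv (Equiv.mulRight ⟨g, hg⟩) _ _ fun k => ?_
    simp
  · rw [h_apply, Finset.sum_congr rfl fun k _ => by rw [hz k k.2]]
    simpa using hz0

theorem max_order_subgroup_no_fixed_points (d : ℕ) (hd : 1 ≤ d)
    (K : Subgroup (Matrix.GeneralLinearGroup (Fin d) ℤ))
    (hKfin : (K : Set (Matrix.GeneralLinearGroup (Fin d) ℤ)).Finite)
    (hKmax : ∀ K' : Subgroup (Matrix.GeneralLinearGroup (Fin d) ℤ),
      (K' : Set (Matrix.GeneralLinearGroup (Fin d) ℤ)).Finite →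
        Nat.card ↥K' ≤ Nat.card ↥K)
    (z : Fin d → ℤ)
    (hz : ∀ g : Matrix.GeneralLinearGroup (Fin d) ℤ, g ∈ K →
      Matrix.mulVec (g : Matrix (Fin d) (Fin d) ℤ) z = z) :
    z = 0 := by
  by_contra hz0
  have : Finite K := hKfin.to_subtype
  obtain ⟨φ, hφ, hφz⟩ := Matrix.GeneralLinearGroup.exists_invariant_functional K hz0 hz
  let ρ : Representation ℤ K (Fin d → ℤ) :=
    (Units.coeHom _).comp (Matrix.GeneralLinearGroup.toLin.toMonoidHom.comp K.subtype)
  have hρ : Function.Injective ρ := Units.val_injective.comp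
    (Matrix.GeneralLinearGroup.toLin.injective.comp K.subtype_injective)
  obtain ⟨σ, hσ⟩ := Representation.exists_injective_prod_units hρ
    (fun g x => hφ g g.2 x) (fun g => hz g g.2) hφz
  let f : K × ℤˣ →* Matrix.GeneralLinearGroup (Fin d) ℤ :=
    Matrix.GeneralLinearGroup.toLin.symm.toMonoidHom.comp σ.toHomUnits
  have hf : Function.Injective f := Matrix.GeneralLinearGroup.toLin.symm.injective.comp
    fun p q hpq => hσ (congrArg Units.val hpq)
  have h_le := hKmax f.range (Set.finite_range f)
  rw [← Nat.card_congr (MonoidHom.ofInjective hf).toEquiv, Nat.card_prod,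
    Nat.card_eq_fintype_card (α := ℤˣ), Fintype.card_units_int] at h_le
  have := Nat.card_pos (α := K)
  omega
end

section
/- Let η, t, n be positive integers and let G be a group with a finite symmetric generating set S containing the identity. Suppose X ⊆ S^t and Q ⊆ G both contain the identity and satisfy X·Q^r ⊆ S^{rn} ⊆ X·Q^{ηr} for r = 1 and for r = 2t+1. Write Q̂ = Q ∪ Q⁻¹ and T = S^{2t+1} ∩ Q̂^{2η}. Then: (i) S ⊆ X·T; (ii) S^j ∩ Q̂^η ⊆ T^j for every j = 1, …, n; and (iii) Q̂ ⊆ T^n ⊆ Q̂^{4^{|X|}·(2t+1)·η}, where |X| is the number of elements of X. -/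
open Pointwise

theorem Set.inv_mul_mem_pow_of_steps {G : Type*} [Group G] {A : Set G} {p : ℕ → G} {n : ℕ}
    (h : ∀ i < n, (p i)⁻¹ * p (i + 1) ∈ A) : (p 0)⁻¹ * p n ∈ A ^ n := by
  induction n with
  | zero => simp
  | succ n ih =>
    rw [pow_succ]
    convert Set.mul_mem_mul (ih fun i hi => h i (by omega)) (h n (by omega)) using 1
    group

theorem Set.exists_path_of_mem_pow {G : Type*} [Group G] {A : Set G} {n : ℕ} {g : G}
    (hg : g ∈ A ^ n) :
    ∃ p : ℕ → G, p 0 = 1 ∧ p n = g ∧ ∀ i < n, (p i)⁻¹ * p (i + 1) ∈ A := by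
  induction n generalizing g with
  | zero => exact ⟨fun _ => 1, rfl, by simpa [eq_comm] using hg, by simp⟩
  | succ n ih =>
    rw [pow_succ] at hg
    obtain ⟨a, ha, b, hb, rfl⟩ := hg
    obtain ⟨p, hp0, hpn, hp⟩ := ih ha
    refine ⟨fun i => if i ≤ n then p i else a * b, by simp [hp0], by simp, fun i hi => ?_⟩
    rcases (Nat.lt_succ_iff.mp hi).eq_or_lt with rfl | h
    · simpa [hpn] using hb
    · simpa [h.le, Nat.succ_le_of_lt h] using hp i h

/-- A path with short steps, coloured so that equally coloured points are close to each other,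
has endpoints whose distance is linear in the number of colours. -/
theorem Set.inv_mul_mem_pow_of_coloring {G ι : Type*} [Group G] {P : Set G} (hP : (1 : G) ∈ P)
    {p : ℕ → G} {c : ℕ → ι} {n : ℕ} (hstep : ∀ i < n, (p i)⁻¹ * p (i + 1) ∈ P)
    (hc : ∀ i ≤ n, ∀ j ≤ n, c i = c j → (p i)⁻¹ * p j ∈ P ^ 2) (Y : Finset ι) (a : ℕ)
    (ha : a ≤ n) (hY : ∀ i, a ≤ i → i ≤ n → c i ∈ Y) :
    (p a)⁻¹ * p n ∈ P ^ (4 * Y.card) := by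
  classical
  induction hk : Y.card generalizing Y a with
  | zero =>
    rw [Finset.card_eq_zero] at hk
    simpa [hk] using hY a le_rfl ha
  | succ k ih =>
    set i := Nat.findGreatest (fun j => c j = c a) n with hi
    have hin : i ≤ n := Nat.findGreatest_le n
    have hci : c i = c a := Nat.findGreatest_spec (P := fun j => c j = c a) ha rfl
    have hai : a ≤ i := Nat.le_findGreatest ha rfl
    have h1 := hc a ha i hin hci.symm
    rcases hin.eq_or_lt with h | h
    · rw [h] at h1
      exact Set.pow_subset_pow_right hP (by omega) h1
    · have h2 := ih (Y.erase (c a)) (i + 1) h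
        (fun j hj hjn => Finset.mem_erase.mpr
          ⟨Nat.findGreatest_is_greatest (P := fun j => c j = c a) hj hjn,
            hY j (by omega) hjn⟩)
        (by rw [Finset.card_erase_of_mem (hY a le_rfl ha)]; omega)
      have h3 := Set.mul_mem_mul (Set.mul_mem_mul h1 (hstep i h)) h2
      rw [← pow_succ, ← pow_add] at h3
      convert Set.pow_subset_pow_right hP (by omega : 2 + 1 + 4 * k ≤ 4 * (k + 1)) h3 using 1
      group

theorem fromStoT (η t n : ℕ) (hη : 0 < η) (ht : 0 < t) (hn : 0 < n)
    (G : Type) [Group G] (S : Set G)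
    (hfin : S.Finite) (hsymm : S⁻¹ = S) (hone : (1 : G) ∈ S)
    (hgen : Subgroup.closure S = ⊤)
    (X Q : Set G) (hX1 : (1 : G) ∈ X) (hQ1 : (1 : G) ∈ Q) (hXS : X ⊆ S ^ t)
    (h1a : X * Q ⊆ S ^ n) (h1b : S ^ n ⊆ X * Q ^ η)
    (h2a : X * Q ^ (2 * t + 1) ⊆ S ^ ((2 * t + 1) * n))
    (h2b : S ^ ((2 * t + 1) * n) ⊆ X * Q ^ (η * (2 * t + 1))) :
    S ⊆ X * (S ^ (2 * t + 1) ∩ (Q ∪ Q⁻¹) ^ (2 * η)) ∧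
    (∀ j : ℕ, 1 ≤ j → j ≤ n →
      S ^ j ∩ (Q ∪ Q⁻¹) ^ η ⊆ (S ^ (2 * t + 1) ∩ (Q ∪ Q⁻¹) ^ (2 * η)) ^ j) ∧
    Q ∪ Q⁻¹ ⊆ (S ^ (2 * t + 1) ∩ (Q ∪ Q⁻¹) ^ (2 * η)) ^ n ∧
    (S ^ (2 * t + 1) ∩ (Q ∪ Q⁻¹) ^ (2 * η)) ^ n ⊆
      (Q ∪ Q⁻¹) ^ (4 ^ Nat.card ↥X * (2 * t + 1) * η) := by
  set R : Set G := Q ∪ Q⁻¹ with hR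
  set T : Set G := S ^ (2 * t + 1) ∩ R ^ (2 * η) with hT
  have hR1 : (1 : G) ∈ R := Or.inl hQ1
  have hRinv : R⁻¹ = R := by rw [hR, Set.union_inv, inv_inv, Set.union_comm]
  have hT1 : (1 : G) ∈ T := ⟨Set.one_mem_pow hone, Set.one_mem_pow hR1⟩
  have hSi (m : ℕ) {g : G} (hg : g ∈ S ^ m) : g⁻¹ ∈ S ^ m := by
    rw [← Set.mem_inv, ← inv_pow, hsymm]; exact hg
  have hRi (m : ℕ) {g : G} (hg : g ∈ R ^ m) : g⁻¹ ∈ R ^ m := by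
    rw [← Set.mem_inv, ← inv_pow, hRinv]; exact hg
  have hQR (m : ℕ) : Q ^ m ⊆ R ^ m := Set.pow_subset_pow_left Set.subset_union_left
  have hii : ∀ j : ℕ, 1 ≤ j → j ≤ n → S ^ j ∩ R ^ η ⊆ T ^ j := by
    rintro j hj hjn g ⟨hgS, hgR⟩
    obtain ⟨p, hp0, hpj, hp⟩ := Set.exists_path_of_mem_pow hgS
    have hx : ∀ i, ∃ x ∈ X, i ≤ j → p i * x ∈ R ^ η ∧ (i = 0 ∨ i = j → x = 1) := by
      intro i
      by_cases hij : i ≤ j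
      · by_cases h0 : i = 0 ∨ i = j
        · refine ⟨1, hX1, fun _ => ⟨?_, fun _ => rfl⟩⟩
          rcases h0 with rfl | rfl
          · simpa [hp0] using Set.one_mem_pow hR1
          · simpa [hpj] using hgR
        · have h1 : p i ∈ S ^ i := by
            simpa [hp0] using
              Set.inv_mul_mem_pow_of_steps (p := p) fun l hl => hp l (hl.trans_le hij)
          obtain ⟨x, hx, q, hq, hxq⟩ :=
            h1b (Set.pow_subset_pow_right hone (hij.trans hjn) (hSi i h1))
          refine ⟨x, hx, fun _ => ⟨?_, fun h => absurd h h0⟩⟩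
          have : p i * x = q⁻¹ := by
            rw [← inv_inv (p i), ← hxq]; group
          rw [this]
          exact hRi η (hQR η hq)
      · exact ⟨1, hX1, fun h => absurd h hij⟩
    choose x hxX hx using hx
    have hpath := Set.inv_mul_mem_pow_of_steps (A := T) (p := fun i => p i * x i) (n := j) (by
      intro i hi
      refine ⟨?_, ?_⟩
      · have h := Set.mul_mem_mul (Set.mul_mem_mul (hSi t (hXS (hxX i))) (hp i hi))
          (hXS (hxX (i + 1)))
        rw [← pow_succ, ← pow_add, show t + 1 + t = 2 * t + 1 by omega] at h
        convert h using 1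
        group
      · rw [two_mul, pow_add]
        exact Set.mul_mem_mul (hRi η (hx i hi.le).1) (hx (i + 1) hi).1)
    simpa [(hx 0 (Nat.zero_le j)).2 (Or.inl rfl), (hx j le_rfl).2 (Or.inr rfl), hp0, hpj]
      using hpath
  refine ⟨?_, hii, ?_, ?_⟩
  · intro s hs
    obtain ⟨x, hx, q, hq, rfl⟩ := h1b (Set.subset_pow hone hn.ne' hs)
    refine Set.mul_mem_mul hx ⟨?_, ?_⟩
    · have h := Set.mul_mem_mul (hSi t (hXS hx)) hs
      rw [← pow_succ] at h
      simpa using Set.pow_subset_pow_right hone (by omega : t + 1 ≤ 2 * t + 1) h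
    · exact Set.pow_subset_pow_right hR1 (by omega) (hQR η hq)
  · have hQS : Q ⊆ S ^ n := fun q hq => h1a (by simpa using Set.mul_mem_mul hX1 hq)
    refine fun q hq => hii n hn le_rfl ⟨?_, Set.subset_pow hR1 hη.ne' hq⟩
    rcases hq with hq | hq
    · exact hQS hq
    · simpa using hSi n (hQS hq)
  · intro g hg
    have hSfin (m : ℕ) : (S ^ m).Finite := by
      induction m with
      | zero => simp
      | succ m ih => rw [pow_succ]; exact ih.mul hfin
    have hXfin : X.Finite := (hSfin t).subset hXS
    obtain ⟨p, hp0, hpn, hp⟩ := Set.exists_path_of_mem_pow hg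
    have hx : ∀ i, ∃ x ∈ X, i ≤ n → x⁻¹ * p i ∈ R ^ (η * (2 * t + 1)) := by
      intro i
      by_cases hin : i ≤ n
      · have h1 : p i ∈ T ^ i := by
          simpa [hp0] using
            Set.inv_mul_mem_pow_of_steps (p := p) fun l hl => hp l (hl.trans_le hin)
        have h2 := Set.pow_subset_pow_left (n := n) (Set.inter_subset_left : T ⊆ S ^ (2 * t + 1))
          (Set.pow_subset_pow_right hT1 hin h1)
        rw [← pow_mul] at h2
        obtain ⟨x, hx, q, hq, hxq⟩ := h2b h2
        refine ⟨x, hx, fun _ => ?_⟩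
        rw [← hxq]
        simpa using hQR _ hq
      · exact ⟨1, hX1, fun h => absurd h hin⟩
    choose x hxX hx using hx
    have key := Set.inv_mul_mem_pow_of_coloring (P := R ^ (η * (2 * t + 1)))
      (Set.one_mem_pow hR1) (p := p) (c := x) (n := n)
      (fun i hi => Set.pow_subset_pow_right hR1 (by nlinarith) (hp i hi).2)
      (fun i hi j hj hij => by
        have h := Set.mul_mem_mul (hRi _ (hx i hi)) (hx j hj)
        rw [← pow_two, hij] at h
        convert h using 1
        group)
      hXfin.toFinset 0 (Nat.zero_le n) (fun i _ _ => by simpa using hxX i)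
    rw [hp0, hpn, inv_one, one_mul, ← pow_mul, ← Set.ncard_eq_toFinset_card X hXfin,
      ← Nat.card_coe_set_eq] at key
    refine Set.pow_subset_pow_right hR1 ?_ key
    have hcard : 4 * Nat.card X ≤ 4 ^ Nat.card X := by
      have : Nonempty X := ⟨⟨1, hX1⟩⟩
      have : Finite X := hXfin
      obtain ⟨k, hk⟩ := Nat.exists_eq_succ_of_ne_zero (Nat.card_pos (α := X)).ne'
      have := Nat.lt_pow_self (n := k) (by norm_num : 1 < 4)
      rw [hk, pow_succ]
      omega
    calc η * (2 * t + 1) * (4 * Nat.card X) = 4 * Nat.card X * (2 * t + 1) * η := by ring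
      _ ≤ _ := by gcongr
end

section
/- Let 𝒢 be a connected vertex-transitive graph, let o be a vertex of 𝒢, and let n be a positive integer such that there exist two vertices of 𝒢 at graph distance greater than n (i.e. n < diam(𝒢)). Then the sphere {v : dist(o, v) = n} contains at least 2 vertices, and the ball {v : dist(o, v) ≤ n} contains at least 2n + 1 vertices. Consequently, if 𝒢 has finite diameter D then 𝒢 has at least 2D vertices. -/
namespace SimpleGraph

variable {V : Type*} {G : SimpleGraph V}

theorem Connected.exists_dist_eq_and_dist_add_eq (hG : G.Connected) (x y : V) {k : ℕ}
    (hk : k ≤ G.dist x y) : ∃ z, G.dist x z = k ∧ k + G.dist z y = G.dist x y := by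
  obtain ⟨p, hp⟩ := hG.exists_walk_length_eq_dist x y
  have h₁ := dist_le (p.take k)
  have h₂ := dist_le (p.drop k)
  rw [Walk.take_length] at h₁
  rw [Walk.drop_length] at h₂
  have h₃ := hG.dist_triangle (u := x) (v := p.getVert k) (w := y)
  exact ⟨p.getVert k, by omega, by omega⟩

theorem Iso.dist_map {W : Type*} {H : SimpleGraph W} (hG : G.Connected) (φ : G ≃g H) (u v : V) :
    H.dist (φ u) (φ v) = G.dist u v := by
  have hH : H.Connected := φ.connected_iff.mp hG
  obtain ⟨p, hp⟩ := hG.exists_walk_length_eq_dist u v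
  obtain ⟨q, hq⟩ := hH.exists_walk_length_eq_dist (φ u) (φ v)
  have h₁ := dist_le (p.map φ.toHom)
  have h₂ := dist_le ((q.map φ.symm.toHom).copy (φ.symm_apply_apply u) (φ.symm_apply_apply v))
  rw [Walk.length_map, hp] at h₁
  rw [Walk.length_copy, Walk.length_map, hq] at h₂
  exact le_antisymm h₁ h₂

/-- If all spheres of radius `n` are subsingletons, but every vertex has another one at distance
`n + 1`, then arbitrarily large distances occur. -/
theorem Connected.exists_dist_eq_of_subsingleton_spheres (hG : G.Connected) {n : ℕ} (hn : 0 < n)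
    (hsub : ∀ x a b, G.dist x a = n → G.dist x b = n → a = b)
    (hfar : ∀ x, ∃ w, G.dist x w = n + 1) (o : V) {m : ℕ} (hm : n + 1 ≤ m) :
    ∃ x v, G.dist x v = m := by
  have tri := fun u v w : V => hG.dist_triangle (u := u) (v := v) (w := w)
  have comm := fun u v : V => G.dist_comm (u := u) (v := v)
  induction m, hm using Nat.le_induction with
  | base => exact ⟨o, hfar o⟩
  | succ m hm ih =>
    obtain ⟨x, v, hxv⟩ := ih
    obtain ⟨y, hxy, hyv⟩ := hG.exists_dist_eq_and_dist_add_eq x v (k := n) (by omega)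
    obtain ⟨w, hyw⟩ := hfar y
    have hxw : n + G.dist x w = n + 1 := by
      obtain ⟨x', hyx', hx'w⟩ := hG.exists_dist_eq_and_dist_add_eq y w (k := n) (by omega)
      obtain rfl := hsub y x x' (by rw [comm, hxy]) hyx'
      omega
    obtain ⟨p, hxp, hpy⟩ := hG.exists_dist_eq_and_dist_add_eq x y (k := n - 1) (by omega)
    have hwp : G.dist w p = n := by
      have := tri w x p
      have := tri w p y
      have := comm w x
      have := comm w y
      omega
    refine ⟨w, v, ?_⟩
    have hwv_le := tri w x v
    have hxv_le := tri x w v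
    have hwx := comm w x
    rcases lt_or_ge n (G.dist w v) with h | h
    · obtain ⟨p', hwp', hp'v⟩ := hG.exists_dist_eq_and_dist_add_eq w v h.le
      obtain rfl := hsub w p p' hwp hwp'
      have := tri x p v
      omega
    · exfalso
      obtain ⟨z, hxz, hzy⟩ := hG.exists_dist_eq_and_dist_add_eq x y (k := 1) (by omega)
      have hvz : G.dist v z = n := by
        have := tri x z v
        have := tri z y v
        have := comm v z
        omega
      obtain rfl := hsub v w z (by rw [comm]; omega) hvz
      have := comm y w
      omega

theorem Connected.two_le_encard_sphere (hG : G.Connected)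
    (htrans : ∀ u v : V, ∃ φ : G ≃g G, φ u = v) {n : ℕ} (hn : 0 < n)
    (hdiam : ∃ u v : V, n < G.dist u v) (o : V) : 2 ≤ {v : V | G.dist o v = n}.encard := by
  by_contra hlt
  have hsub_o : {v : V | G.dist o v = n}.encard ≤ 1 :=
    Order.le_of_lt_add_one (by simpa [one_add_one_eq_two] using hlt)
  rw [Set.encard_le_one_iff] at hsub_o
  have hsub : ∀ x a b, G.dist x a = n → G.dist x b = n → a = b := by
    intro x a b ha hb
    obtain ⟨φ, rfl⟩ := htrans x o
    exact φ.injective (hsub_o _ _ ((φ.dist_map hG x a).trans ha) ((φ.dist_map hG x b).trans hb))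
  have hfar : ∀ x, ∃ w, G.dist x w = n + 1 := by
    intro x
    obtain ⟨u, v, huv⟩ := hdiam
    obtain ⟨φ, rfl⟩ := htrans u x
    obtain ⟨w, hw, -⟩ := hG.exists_dist_eq_and_dist_add_eq u v (k := n + 1) huv
    exact ⟨φ w, (φ.dist_map hG u w).trans hw⟩
  obtain ⟨x, v, hxv⟩ := hG.exists_dist_eq_of_subsingleton_spheres hn hsub hfar o
    (m := 2 * n) (by omega)
  obtain ⟨c, hxc, hcv⟩ := hG.exists_dist_eq_and_dist_add_eq x v (k := n) (by omega)
  obtain rfl := hsub c x v (by rw [dist_comm, hxc]) (by omega)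
  rw [dist_self] at hxv
  omega

theorem Connected.two_mul_add_one_le_encard_ball (hG : G.Connected)
    (htrans : ∀ u v : V, ∃ φ : G ≃g G, φ u = v) {n : ℕ}
    (hdiam : ∃ u v : V, n < G.dist u v) (o : V) :
    (2 * n + 1 : ℕ) ≤ {v : V | G.dist o v ≤ n}.encard := by
  induction n with
  | zero => exact Set.one_le_encard_iff_nonempty.mpr ⟨o, by simp⟩
  | succ n ih =>
    have hball := ih (hdiam.imp fun u h => h.imp fun v h => by omega)
    have hsphere := hG.two_le_encard_sphere htrans n.succ_pos hdiam o
    have hunion : {v : V | G.dist o v ≤ n + 1} =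
        {v : V | G.dist o v ≤ n} ∪ {v : V | G.dist o v = n + 1} := by
      ext v
      simp only [Set.mem_ofPred_eq, Set.mem_union]
      omega
    rw [hunion, Set.encard_union_eq (Set.disjoint_left.mpr fun v hv hv' => by
      simp only [Set.mem_ofPred_eq] at hv hv'
      omega)]
    calc ((2 * (n + 1) + 1 : ℕ) : ℕ∞) = (2 * n + 1 : ℕ) + 2 := by push_cast; ring
      _ ≤ _ := add_le_add hball hsphere

end SimpleGraph

theorem sphere_size_at_least_two (V : Type) (G : SimpleGraph V)
    (hconn : G.Connected) (htrans : ∀ u v : V, ∃ φ : G ≃g G, φ u = v) (o : V) :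
    (∀ n : ℕ, 0 < n → (∃ u v : V, n < G.dist u v) →
      2 ≤ {v : V | G.dist o v = n}.encard ∧
      (2 * n + 1 : ℕ) ≤ {v : V | G.dist o v ≤ n}.encard) ∧
    -- consequently, if `G` has finite diameter `D` then `G` has at least `2 D` vertices
    (∀ D : ℕ, (∀ u v : V, G.dist u v ≤ D) → (∃ u v : V, G.dist u v = D) →
      (2 * D : ℕ) ≤ (Set.univ : Set V).encard) := by
  refine ⟨fun n hn hdiam => ⟨hconn.two_le_encard_sphere htrans hn hdiam o,
    hconn.two_mul_add_one_le_encard_ball htrans hdiam o⟩, ?_⟩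
  rintro (_ | n) - ⟨u, v, huv⟩
  · simp
  · have hball := hconn.two_mul_add_one_le_encard_ball htrans ⟨u, v, by omega⟩ u (n := n)
    have hv : v ∉ {w : V | G.dist u w ≤ n} := by
      simp only [Set.mem_ofPred_eq]
      omega
    calc ((2 * (n + 1) : ℕ) : ℕ∞) = (2 * n + 1 : ℕ) + 1 := by push_cast; ring
      _ ≤ {w : V | G.dist u w ≤ n}.encard + 1 := by gcongr
      _ = (insert v {w : V | G.dist u w ≤ n}).encard := (Set.encard_insert_of_notMem hv).symm
      _ ≤ _ := Set.encard_le_encard (Set.subset_univ _)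
end

section
/- Let 𝒢 be a connected k-regular graph (every vertex has exactly k neighbours), let x be a vertex of 𝒢, and let n be a positive integer such that some vertex of 𝒢 is at graph distance at least n from x (i.e. n ≤ rad_x(𝒢)). Then the ball {v : dist(x, v) ≤ n} contains at least (1/3)·(k+1)·n vertices, i.e. 3·|B_𝒢(x, n)| ≥ (k+1)·n. -/
namespace SimpleGraph

variable {V : Type*} {G : SimpleGraph V}

lemma Connected.dist_le_dist_add_one (hconn : G.Connected) (x : V) {u v : V} (h : G.Adj u v) :
    G.dist x v ≤ G.dist x u + 1 := by
  have h₁ := hconn.dist_triangle (u := x) (v := u) (w := v)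
  rwa [dist_eq_one_iff_adj.mpr h] at h₁

lemma Connected.exists_dist_eq_of_le (hconn : G.Connected) {x v : V} {i : ℕ}
    (hi : i ≤ G.dist x v) : ∃ w, G.dist x w = i := by
  obtain ⟨p⟩ := hconn.preconnected v x
  induction p with
  | nil => exact ⟨_, le_antisymm (by simp) hi⟩
  | @cons v u x h p ih =>
    by_cases hu : i ≤ G.dist x u
    · exact ih hu
    · have := hconn.dist_le_dist_add_one x h.symm
      exact ⟨v, by omega⟩

lemma encard_insert_neighborSet (v : V) :
    (insert v (G.neighborSet v)).encard = (G.neighborSet v).encard + 1 :=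
  Set.encard_insert_of_notMem (by simp)

lemma Connected.mul_le_three_mul_encard_ball (hconn : G.Connected) {k : ℕ}
    (hreg : ∀ v : V, (G.neighborSet v).encard = k) (x : V) :
    ∀ n : ℕ, (∃ v : V, n ≤ G.dist x v) →
      (((k + 1) * n : ℕ) : ℕ∞) ≤ 3 * {v : V | G.dist x v ≤ n}.encard
  | 0, _ => by simp
  | n + 1, hrad => by
    by_cases hn : n < 3
    · have hsub : insert x (G.neighborSet x) ⊆ {v : V | G.dist x v ≤ n + 1} := by
        rintro w (rfl | hw)
        · simp
        · have : G.dist x w = 1 := dist_eq_one_iff_adj.mpr hw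
          simp [this]
      calc (((k + 1) * (n + 1) : ℕ) : ℕ∞) ≤ ((3 * (k + 1) : ℕ) : ℕ∞) := by
            rw [Nat.cast_le, mul_comm]
            gcongr
            omega
        _ = 3 * (insert x (G.neighborSet x)).encard := by
            rw [encard_insert_neighborSet, hreg]
            push_cast
            rfl
        _ ≤ _ := by
            gcongr
    · obtain ⟨m, rfl⟩ : ∃ m, n = m + 3 := ⟨n - 3, by omega⟩
      obtain ⟨v, hv⟩ := hrad
      have ih := hconn.mul_le_three_mul_encard_ball hreg x (m + 1) ⟨v, by omega⟩
      obtain ⟨w, hw⟩ := hconn.exists_dist_eq_of_le (show m + 3 ≤ G.dist x v by omega)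
      have hnbr : ∀ u ∈ insert w (G.neighborSet w),
          m + 2 ≤ G.dist x u ∧ G.dist x u ≤ m + 4 := by
        rintro u (rfl | hu)
        · omega
        · have h₁ := hconn.dist_le_dist_add_one x hu
          have h₂ := hconn.dist_le_dist_add_one x (G.adj_symm hu)
          omega
      have hdisj : Disjoint {v : V | G.dist x v ≤ m + 1} (insert w (G.neighborSet w)) :=
        Set.disjoint_left.mpr fun u hu hu' => by
          have := (hnbr u hu').1
          simp only [Set.mem_ofPred_eq] at hu
          omega
      have hsub : {v : V | G.dist x v ≤ m + 1} ∪ insert w (G.neighborSet w) ⊆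
          {v : V | G.dist x v ≤ m + 3 + 1} := by
        rintro u (hu | hu)
        · simp only [Set.mem_ofPred_eq] at hu ⊢
          omega
        · exact (hnbr u hu).2
      calc (((k + 1) * (m + 3 + 1) : ℕ) : ℕ∞)
          = (((k + 1) * (m + 1) : ℕ) : ℕ∞) + 3 * ((k : ℕ∞) + 1) := by
            push_cast
            ring
        _ ≤ 3 * {v : V | G.dist x v ≤ m + 1}.encard
            + 3 * (insert w (G.neighborSet w)).encard := by
            rw [encard_insert_neighborSet, hreg]
            gcongr
        _ = 3 * ({v : V | G.dist x v ≤ m + 1} ∪ insert w (G.neighborSet w)).encard := by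
            rw [Set.encard_union_eq hdisj, mul_add]
        _ ≤ _ := by
            gcongr

end SimpleGraph

theorem ball_lower_bound_regular_graph (V : Type) (G : SimpleGraph V) (k : ℕ)
    (hconn : G.Connected)
    -- `G` is `k`-regular: every vertex has exactly `k` neighbours
    (hreg : ∀ v : V, (G.neighborSet v).encard = k)
    (x : V) (n : ℕ) (hn : 0 < n)
    (hrad : ∃ v : V, n ≤ G.dist x v) :
    ((k + 1) * n : ℕ) ≤ 3 * {v : V | G.dist x v ≤ n}.encard :=
  hconn.mul_le_three_mul_encard_ball hreg x n hrad
end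

section
/- Let d and r be positive integers with r ≥ d, let M₁, …, M_r be positive reals, and suppose v₁, …, v_r are vectors spanning ℝ^d. Then there exist indices 1 ≤ i₁ < i₂ < ⋯ < i_d ≤ r such that every vector of the form ℓ₁v₁ + ⋯ + ℓ_rv_r with ℓ_i ∈ ℝ and |ℓ_i| ≤ M_i for each i can be written as c₁v_{i₁} + ⋯ + c_dv_{i_d} with c_j ∈ ℝ and |c_j| ≤ r·M_{i_j} for each j. Equivalently, B_ℝ(v; M) ⊆ r·B_ℝ(v_{i₁},…,v_{i_d}; M_{i₁},…,M_{i_d}), where B_ℝ(w; L) = {ℓ₁w₁ + ⋯ + ℓ_kw_k : ℓ_i ∈ ℝ, |ℓ_i| ≤ L_i}. -/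
/-- If the rows of `A` are drawn from a family `w` so as to maximise `|det|`, then every member of
the family is a combination of those rows with coefficients of absolute value at most one. -/
lemma exists_bounded_coeff_of_det_max {d : ℕ} {α : Type*} (w : α → Fin d → ℝ) (f : Fin d → α)
    (hne : (Matrix.of fun j => w (f j)).det ≠ 0)
    (hmax : ∀ g : Fin d → α,
      |(Matrix.of fun j => w (g j)).det| ≤ |(Matrix.of fun j => w (f j)).det|) (i : α) :
    ∃ t : Fin d → ℝ, (∀ j, |t j| ≤ 1) ∧ w i = ∑ j, t j • w (f j) := by
  set A : Matrix (Fin d) (Fin d) ℝ := Matrix.of fun j => w (f j) with hA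
  have hcramer : ∀ j, Matrix.cramer A.transpose (w i) j
      = (Matrix.of fun k => w (Function.update f j i k)).det := by
    intro j
    rw [Matrix.cramer_transpose_apply]
    congr 1
    ext k l
    by_cases h : k = j
    · subst h; simp
    · simp [Matrix.updateRow_apply, h, hA]
  refine ⟨fun j => Matrix.cramer A.transpose (w i) j / A.det, fun j => ?_, ?_⟩
  · rw [abs_div, hcramer]
    exact div_le_one_of_le₀ (hmax _) (abs_nonneg _)
  · have h := Matrix.mulVec_cramer A.transpose (w i)
    rw [Matrix.det_transpose] at h
    ext l
    have hl := congrFun h l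
    simp only [Matrix.mulVec, dotProduct, Matrix.transpose_apply, Pi.smul_apply,
      smul_eq_mul] at hl
    rw [Finset.sum_apply, eq_comm]
    refine mul_left_cancel₀ hne ?_
    rw [← hl, Finset.mul_sum]
    refine Finset.sum_congr rfl fun j _ => ?_
    simp only [Pi.smul_apply, smul_eq_mul]
    field_simp
    simp [hA]

/-- A family spanning `ℝ^d` contains `d` vectors with nonzero determinant. -/
lemma exists_det_ne_zero_of_span_eq_top {d : ℕ} {α : Type*} [Finite α] (w : α → Fin d → ℝ)
    (hspan : Submodule.span ℝ (Set.range w) = ⊤) :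
    ∃ f : Fin d → α, (Matrix.of fun j => w (f j)).det ≠ 0 := by
  obtain ⟨κ, a, ha, hs, hli⟩ := exists_linearIndependent' ℝ w
  have : Finite κ := Finite.of_injective a ha
  have : Fintype κ := Fintype.ofFinite κ
  let b : Module.Basis κ ℝ (Fin d → ℝ) := Module.Basis.mk hli (by rw [hs, hspan])
  have hcard : Fintype.card κ = d := by
    rw [← Module.finrank_eq_card_basis b, Module.finrank_fin_fun]
  let e : Fin d ≃ κ := (Fintype.equivFinOfCardEq hcard).symm
  refine ⟨a ∘ e, ?_⟩
  have hli' : LinearIndependent ℝ (Matrix.of fun j => w ((a ∘ e) j)).row :=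
    hli.comp e e.injective
  exact ((Matrix.isUnit_iff_isUnit_det _).1
    (Matrix.linearIndependent_rows_iff_isUnit.1 hli')).ne_zero

/-- Among strictly increasing choices of rows from a spanning family, one attains the maximal
nonzero value of `|det|` over all choices. -/
lemma exists_strictMono_det_max {d : ℕ} {α : Type*} [Finite α] [LinearOrder α]
    (w : α → Fin d → ℝ) (hspan : Submodule.span ℝ (Set.range w) = ⊤) :
    ∃ f : Fin d → α, StrictMono f ∧ (Matrix.of fun j => w (f j)).det ≠ 0 ∧
      ∀ g : Fin d → α,
        |(Matrix.of fun j => w (g j)).det| ≤ |(Matrix.of fun j => w (f j)).det| := by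
  obtain ⟨f₀, hf₀⟩ := exists_det_ne_zero_of_span_eq_top w hspan
  have : Nonempty (Fin d → α) := ⟨f₀⟩
  obtain ⟨f, hf⟩ := Finite.exists_max fun g : Fin d → α => |(Matrix.of fun j => w (g j)).det|
  have hperm : |(Matrix.of fun j => w ((f ∘ Tuple.sort f) j)).det|
      = |(Matrix.of fun j => w (f j)).det| := by
    have h := Matrix.det_permute (Tuple.sort f) (Matrix.of fun j => w (f j))
    have h' : (Matrix.of fun j => w ((f ∘ Tuple.sort f) j))
        = (Matrix.of fun j => w (f j)).submatrix (Tuple.sort f) id := rfl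
    rw [h', h, abs_mul]
    rcases Int.units_eq_one_or (Equiv.Perm.sign (Tuple.sort f)) with hs | hs <;> simp [hs]
  have hne : (Matrix.of fun j => w (f j)).det ≠ 0 :=
    abs_pos.1 ((abs_pos.2 hf₀).trans_le (hf f₀))
  have hinj : Function.Injective f := by
    intro i j hij
    by_contra h
    exact hne (Matrix.det_zero_of_row_eq h (congrArg w hij))
  refine ⟨f ∘ Tuple.sort f, (Tuple.monotone_sort f).strictMono_of_injective
    (hinj.comp (Tuple.sort f).injective), ?_, fun g => hperm ▸ hf g⟩
  rw [← abs_pos, hperm]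
  exact abs_pos.2 hne

theorem cramer_box_reduction (d r : ℕ) (hd : 0 < d) (hr : d ≤ r)
    (M : Fin r → ℝ) (hM : ∀ i, 0 < M i)
    (v : Fin r → (Fin d → ℝ))
    (hspan : Submodule.span ℝ (Set.range v) = ⊤) :
    ∃ ι : Fin d → Fin r, StrictMono ι ∧
      ∀ ℓ : Fin r → ℝ, (∀ i, |ℓ i| ≤ M i) →
        ∃ c : Fin d → ℝ, (∀ j, |c j| ≤ (r : ℝ) * M (ι j)) ∧
          ∑ i, ℓ i • v i = ∑ j, c j • v (ι j) := by
  have hspan' : Submodule.span ℝ (Set.range fun i => M i • v i) = ⊤ := by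
    rw [eq_top_iff, ← hspan, Submodule.span_le]
    rintro _ ⟨i, rfl⟩
    have h := Submodule.smul_mem _ (M i)⁻¹
      (Submodule.subset_span (R := ℝ) (Set.mem_range_self (f := fun i => M i • v i) i))
    simpa [smul_smul, (hM i).ne'] using h
  obtain ⟨ι, hι, hne, hmax⟩ := exists_strictMono_det_max _ hspan'
  choose t ht hsum using exists_bounded_coeff_of_det_max (fun i => M i • v i) ι hne hmax
  refine ⟨ι, hι, fun ℓ hℓ => ⟨fun j => (∑ i, ℓ i / M i * t i j) * M (ι j), fun j => ?_, ?_⟩⟩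
  · rw [abs_mul, abs_of_pos (hM _)]
    refine mul_le_mul_of_nonneg_right ?_ (hM _).le
    calc |∑ i, ℓ i / M i * t i j| ≤ ∑ i, |ℓ i / M i * t i j| := Finset.abs_sum_le_sum_abs _ _
      _ ≤ ∑ _i : Fin r, (1 : ℝ) := Finset.sum_le_sum fun i _ => by
          rw [abs_mul, abs_div, abs_of_pos (hM i)]
          exact mul_le_one₀ (div_le_one_of_le₀ (hℓ i) (hM i).le) (abs_nonneg _) (ht i j)
      _ = r := by simp
  · calc ∑ i, ℓ i • v i = ∑ i, (ℓ i / M i) • (M i • v i) :=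
          Finset.sum_congr rfl fun i _ => by rw [smul_smul, div_mul_cancel₀ _ (hM i).ne']
      _ = ∑ i, ∑ j, (ℓ i / M i * t i j) • (M (ι j) • v (ι j)) :=
          Finset.sum_congr rfl fun i _ => by
            rw [hsum i, Finset.smul_sum]
            simp only [smul_smul, mul_assoc]
      _ = ∑ j, ((∑ i, ℓ i / M i * t i j) * M (ι j)) • v (ι j) := by
          rw [Finset.sum_comm]
          refine Finset.sum_congr rfl fun j _ => ?_
          rw [← Finset.sum_smul, smul_smul]
end
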